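/- arXiv:math/0004164 — 3 statements merged into one kernel-verified Lean document; each statement's English description precedes it below -/
import Mathlib

section
/- For every ε > 0 there exists a finite constant C such that for all integers h ≥ 1, k ≥ 0 and p ≥ 0, if the chain Z starts at k then Σ_{x=1}^∞ P(B_{x,h,p}) ≤ C·h. -/
open MeasureTheory ProbabilityTheory
open scoped ENNReal

/-- ρ(i,j) := 2^{−i−j−1}·(i+j)!/(i!·j!). -/
noncomputable def rho (i j : ℕ) : ℝ :=
  (2 : ℝ) ^ (-(i : ℝ) - (j : ℝ) - 1) * (Nat.factorial (i + j)) /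
    ((Nat.factorial i) * (Nat.factorial j))

/-- `Z` is a Markov chain with transition probabilities `trans` started at `k`:
`P(Z_0 = k) = 1` and
`P(Z_0 = k_0, …, Z_n = k_n) = P(Z_0 = k_0) · ∏_{0 ≤ i < n} trans(k_i, k_{i+1})`. -/
def IsMarkovChainFrom {Ω : Type*} [MeasurableSpace Ω] (P : Measure Ω)
    (Z : ℕ → Ω → ℕ) (trans : ℕ → ℕ → ℝ) (k : ℕ) : Prop :=
  (∀ t, Measurable (Z t)) ∧
    ∀ (n : ℕ) (ks : ℕ → ℕ),
      P {ω | ∀ i ≤ n, Z i ω = ks i} =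
        ENNReal.ofReal ((if ks 0 = k then 1 else 0) *
          ∏ i ∈ Finset.range n, trans (ks i) (ks (i + 1)))

/-- `Z̃_t := Z_t + Z_{t−1} + 1`. -/
def Ztil {Ω : Type*} (Z : ℕ → Ω → ℕ) (t : ℕ) (ω : Ω) : ℕ :=
  Z t ω + Z (t - 1) ω + 1

/-- `τ̃_h := inf{t ≥ 1 : Z̃_t ≥ h}` (with value `∞` if there is no such `t`). -/
noncomputable def tauTil {Ω : Type*} (Z : ℕ → Ω → ℕ) (h : ℕ) (ω : Ω) : ℕ∞ :=
  sInf ((↑) '' {t : ℕ | 1 ≤ t ∧ h ≤ Ztil Z t ω} : Set ℕ∞)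

/-- The event `B_{x,h,p}`: for `p = 0` it is `{τ̃_h ≥ x}`; for `p ≥ 1` it is
`{max{Z̃_t : 1 ≤ t < x} = h and #{1 ≤ t < x : Z̃_t = h} = p}`. -/
noncomputable def eventB {Ω : Type*} (Z : ℕ → Ω → ℕ) (x h p : ℕ) : Set Ω :=
  if p = 0 then {ω | (x : ℕ∞) ≤ tauTil Z h ω}
  else {ω | (∀ t, 1 ≤ t → t < x → Ztil Z t ω ≤ h) ∧
        {t : ℕ | 1 ≤ t ∧ t < x ∧ Ztil Z t ω = h}.encard = (p : ℕ∞)}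

/-- The mass function `rho i` is that of a negative binomial law. -/
lemma rho_eq (i j : ℕ) :
    rho i j = (1 / 2) ^ (i + 1) * (((j + i).choose i : ℝ) * (1 / 2) ^ j) := by
  have h2 : (2 : ℝ) ^ (-(i : ℝ) - (j : ℝ) - 1) = (1 / 2) ^ (i + 1) * (1 / 2) ^ j := by
    rw [← pow_add, one_div, inv_pow, ← Real.rpow_natCast, ← Real.rpow_neg (by norm_num)]
    congr 1
    push_cast
    ring
  rw [rho, h2, Nat.cast_choose ℝ (Nat.le_add_left i j), Nat.add_sub_cancel, add_comm j i]
  field_simp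

lemma rho_nonneg (i j : ℕ) : 0 ≤ rho i j := by
  rw [rho_eq]
  positivity

/-- The probability generating function of `rho i`. -/
lemma hasSum_rho_mul_pow (i : ℕ) {r : ℝ} (hr0 : 0 ≤ r) (hr1 : r ≤ 1) :
    HasSum (fun j => rho i j * r ^ j) (1 / (2 - r) ^ (i + 1)) := by
  have hr : ‖r / 2‖ < 1 := by
    rw [Real.norm_of_nonneg (by positivity)]
    linarith
  have hs := (hasSum_choose_mul_geometric_of_norm_lt_one i hr).mul_left ((1 / 2 : ℝ) ^ (i + 1))
  have hlim : (1 / 2 : ℝ) ^ (i + 1) * (1 / (1 - r / 2) ^ (i + 1)) = 1 / (2 - r) ^ (i + 1) := by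
    rw [← one_div_pow, ← one_div_pow, ← mul_pow, one_div_mul_one_div,
      show 2 * (1 - r / 2) = 2 - r by ring]
  rw [hlim] at hs
  refine hs.congr_fun fun j => ?_
  rw [rho_eq, div_eq_mul_one_div r 2, mul_pow]
  ring

/-- A bounded function that decreases in mean by at least one per step below level `h`. -/
noncomputable def lyapunov (h i : ℕ) : ℝ := 1 + 16 * h * (1 - 1 / (4 * h)) ^ i

lemma lyapunov_drift {h i : ℕ} (hi : i < h) :
    1 ≤ 16 * h * ((1 - 1 / (4 * h) : ℝ) ^ i - 1 / (1 + 1 / (4 * h)) ^ (i + 1)) := by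
  have hh : (1 : ℝ) ≤ h := by exact_mod_cast (by omega : 1 ≤ h)
  have hih : (i : ℝ) + 1 ≤ h := by exact_mod_cast hi
  set δ : ℝ := 1 / (4 * h) with hδ
  have hδh : δ * h = 1 / 4 := by rw [hδ]; field_simp
  have hδ0 : 0 < δ := by positivity
  have hδ1 : δ ≤ 1 / 4 := by nlinarith
  have hiδ : (i + 1) * δ ≤ 1 / 4 := by nlinarith
  have hb : 1 - i * δ ^ 2 ≤ (1 - δ ^ 2) ^ i := by
    have := one_add_mul_le_pow (a := -δ ^ 2) (by nlinarith) i
    calc 1 - i * δ ^ 2 = 1 + i * (-δ ^ 2) := by ring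
      _ ≤ (1 + -δ ^ 2) ^ i := this
      _ = _ := by ring
  have hc : 3 / 4 ≤ 1 / (1 + δ) ^ (i + 1) := by
    have h1 := one_add_mul_le_pow (a := -δ) (by linarith) (i + 1)
    push_cast at h1
    calc (3 / 4 : ℝ) ≤ (1 + -δ) ^ (i + 1) := by linarith
      _ ≤ (1 / (1 + δ)) ^ (i + 1) := by
        refine pow_le_pow_left₀ (by linarith) ?_ _
        rw [le_div_iff₀ (by linarith)]
        nlinarith
      _ = _ := by rw [one_div_pow]
  have key : (1 - δ) ^ i - 1 / (1 + δ) ^ (i + 1)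
      = 1 / (1 + δ) ^ (i + 1) * ((1 - δ ^ 2) ^ i * (1 + δ) - 1) := by
    rw [show 1 - δ ^ 2 = (1 - δ) * (1 + δ) by ring, mul_pow]
    field_simp
    ring
  have hd : δ / 2 ≤ (1 - δ ^ 2) ^ i * (1 + δ) - 1 := by
    have h1 : i * δ ^ 2 ≤ δ / 4 := by nlinarith
    nlinarith
  rw [key]
  have : 3 / 4 * (δ / 2) ≤ 1 / (1 + δ) ^ (i + 1) * ((1 - δ ^ 2) ^ i * (1 + δ) - 1) :=
    mul_le_mul hc hd (by positivity) (by positivity)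
  nlinarith

lemma lyapunov_supersolution {h : ℕ} (hh : 1 ≤ h) (i : ℕ) :
    1 + ∑' j, ENNReal.ofReal (rho i j) *
        (if i + j + 1 < h then ENNReal.ofReal (lyapunov h j) else 0)
      ≤ ENNReal.ofReal (lyapunov h i) := by
  have hh' : (1 : ℝ) ≤ h := by exact_mod_cast hh
  have hδ0 : (0 : ℝ) < 1 / (4 * h) := by positivity
  have hδ1 : (1 : ℝ) / (4 * h) ≤ 1 := by rw [div_le_one (by positivity)]; linarith
  have hq : (0 : ℝ) ≤ 1 - 1 / (4 * h) := by linarith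
  rcases lt_or_ge i h with hi | hi
  · have hs : HasSum (fun j => rho i j * lyapunov h j)
        (1 + 16 * h * (1 / (1 + 1 / (4 * h)) ^ (i + 1))) := by
      convert (hasSum_rho_mul_pow i zero_le_one le_rfl).add
        ((hasSum_rho_mul_pow i hq (by linarith)).mul_left (16 * h : ℝ)) using 1
      · funext j
        rw [lyapunov]
        ring
      · ring
    have h0 : ∀ j, 0 ≤ rho i j * lyapunov h j := fun j =>
      mul_nonneg (rho_nonneg i j) (by rw [lyapunov]; positivity)
    calc _ ≤ 1 + ∑' j, ENNReal.ofReal (rho i j * lyapunov h j) := by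
          gcongr with j
          rw [ENNReal.ofReal_mul (rho_nonneg i j)]
          gcongr
          split_ifs <;> simp
      _ = ENNReal.ofReal (1 + (1 + 16 * h * (1 / (1 + 1 / (4 * h)) ^ (i + 1)))) := by
          rw [← ENNReal.ofReal_tsum_of_nonneg h0 hs.summable, hs.tsum_eq,
            ENNReal.ofReal_add zero_le_one
              (by positivity : 0 ≤ 1 + 16 * (h : ℝ) * (1 / (1 + 1 / (4 * h)) ^ (i + 1))),
            ENNReal.ofReal_one]
      _ ≤ _ := by
          apply ENNReal.ofReal_le_ofReal
          have := lyapunov_drift hi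
          rw [lyapunov]
          linarith
  · have h0 : ∀ j, ¬ i + j + 1 < h := fun j => by omega
    simp only [h0, if_false, mul_zero, tsum_zero, add_zero]
    rw [ENNReal.one_le_ofReal, lyapunov]
    have : (0 : ℝ) ≤ 16 * h * (1 - 1 / (4 * h)) ^ i := by positivity
    linarith

lemma lyapunov_le {h : ℕ} (hh : 1 ≤ h) (i : ℕ) : lyapunov h i ≤ 17 * h := by
  have hh' : (1 : ℝ) ≤ h := by exact_mod_cast hh
  have hδ0 : (0 : ℝ) < 1 / (4 * h) := by positivity
  have hδ1 : (1 : ℝ) / (4 * h) ≤ 1 := by rw [div_le_one (by positivity)]; linarith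
  have : (1 - 1 / (4 * h) : ℝ) ^ i ≤ 1 := pow_le_one₀ (by linarith) (by linarith)
  rw [lyapunov]
  nlinarith

section Markov

variable {Ω : Type*} [MeasurableSpace Ω] {P : Measure Ω} {Z : ℕ → Ω → ℕ}
  {trans : ℕ → ℕ → ℝ} {k : ℕ}

lemma IsMarkovChainFrom.measure_path_next (hZ : IsMarkovChainFrom P Z trans k)
    (htrans : ∀ i j, 0 ≤ trans i j) (n : ℕ) (w : Fin (n + 1) → ℕ) (j : ℕ) :
    P {ω | (fun t : Fin (n + 1) => Z t ω) = w ∧ Z (n + 1) ω = j}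
      = ENNReal.ofReal (trans (w (Fin.last n)) j)
        * P {ω | (fun t : Fin (n + 1) => Z t ω) = w} := by
  let ks : ℕ → ℕ := fun t => if ht : t < n + 1 then w ⟨t, ht⟩ else j
  have hks : ∀ ω, (∀ i ≤ n, Z i ω = ks i) ↔ (fun t : Fin (n + 1) => Z t ω) = w := by
    intro ω
    constructor
    · intro H
      funext t
      have := H t (by omega)
      simpa [ks, Nat.le_of_lt_succ t.2] using this
    · rintro rfl i hi
      simp [ks, hi]
  have h1 : {ω | (fun t : Fin (n + 1) => Z t ω) = w ∧ Z (n + 1) ω = j}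
      = {ω | ∀ i ≤ n + 1, Z i ω = ks i} := by
    ext ω
    simp only [Set.mem_ofPred_eq, ← hks]
    constructor
    · rintro ⟨H, hj⟩ i hi
      rcases Nat.lt_or_ge n i with hi' | hi'
      · obtain rfl : i = n + 1 := by omega
        simpa [ks] using hj
      · exact H i hi'
    · intro H
      refine ⟨fun i hi => H i (by omega), ?_⟩
      simpa [ks] using H (n + 1) le_rfl
  have h2 : {ω | (fun t : Fin (n + 1) => Z t ω) = w} = {ω | ∀ i ≤ n, Z i ω = ks i} := by
    ext ω
    exact (hks ω).symm
  have h3 : trans (ks n) (ks (n + 1)) = trans (w (Fin.last n)) j := by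
    simp [ks, Fin.last]
  rw [h1, h2, hZ.2, hZ.2, Finset.prod_range_succ, ← mul_assoc, mul_comm, h3,
    ENNReal.ofReal_mul (htrans _ _)]

/-- The Markov property, for functions of the path up to time `n` and of the next state. -/
lemma IsMarkovChainFrom.lintegral_path_next (hZ : IsMarkovChainFrom P Z trans k)
    (htrans : ∀ i j, 0 ≤ trans i j) (n : ℕ) (F : (Fin (n + 1) → ℕ) → ℕ → ℝ≥0∞) :
    ∫⁻ ω, F (fun t => Z t ω) (Z (n + 1) ω) ∂P
      = ∫⁻ ω, ∑' j, ENNReal.ofReal (trans (Z n ω) j) * F (fun t => Z t ω) j ∂P := by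
  have hW : Measurable (fun ω => fun t : Fin (n + 1) => Z t ω) :=
    measurable_pi_lambda _ fun t => hZ.1 t
  have hWZ := hW.prodMk (hZ.1 (n + 1))
  have hL : ∫⁻ ω, F (fun t => Z t ω) (Z (n + 1) ω) ∂P
      = ∫⁻ y, F y.1 y.2 ∂(P.map fun ω => ((fun t : Fin (n + 1) => Z t ω), Z (n + 1) ω)) :=
    (lintegral_map (f := fun y : (Fin (n + 1) → ℕ) × ℕ => F y.1 y.2)
      (measurable_of_countable _) hWZ).symm
  have hR : ∫⁻ ω, ∑' j, ENNReal.ofReal (trans (Z n ω) j) * F (fun t => Z t ω) j ∂P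
      = ∫⁻ w, ∑' j, ENNReal.ofReal (trans (w (Fin.last n)) j) * F w j
          ∂(P.map fun ω => fun t : Fin (n + 1) => Z t ω) :=
    (lintegral_map (f := fun w : Fin (n + 1) → ℕ =>
      ∑' j, ENNReal.ofReal (trans (w (Fin.last n)) j) * F w j)
      (measurable_of_countable _) hW).symm
  rw [hL, hR, lintegral_countable', lintegral_countable', ENNReal.tsum_prod']
  refine tsum_congr fun w => ?_
  rw [← ENNReal.tsum_mul_right]
  refine tsum_congr fun j => ?_
  rw [Measure.map_apply hWZ (measurableSet_singleton _),
    Measure.map_apply hW (measurableSet_singleton _)]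
  have := hZ.measure_path_next htrans n w j
  have e1 : (fun ω => ((fun t : Fin (n + 1) => Z t ω), Z (n + 1) ω)) ⁻¹' {(w, j)}
      = {ω | (fun t : Fin (n + 1) => Z t ω) = w ∧ Z (n + 1) ω = j} := by
    ext ω
    simp
  have e2 : (fun ω => fun t : Fin (n + 1) => Z t ω) ⁻¹' {w}
      = {ω | (fun t : Fin (n + 1) => Z t ω) = w} := rfl
  rw [e1, e2, this]
  ring

end Markov

/-- The path `z` has `z t + z (t - 1) + 1 ≤ h` for `1 ≤ t ≤ x`, with equality `p` times. -/
def HitsMaxAt (h p x : ℕ) (z : ℕ → ℕ) : Prop :=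
  (∀ t ∈ Finset.Icc 1 x, z t + z (t - 1) + 1 ≤ h) ∧
    ((Finset.Icc 1 x).filter fun t => z t + z (t - 1) + 1 = h).card = p

lemma HitsMaxAt.congr {h p x : ℕ} {z z' : ℕ → ℕ} (H : HitsMaxAt h p x z)
    (hz : ∀ t ≤ x, z t = z' t) : HitsMaxAt h p x z' := by
  have hz1 : ∀ t ∈ Finset.Icc 1 x, z t + z (t - 1) + 1 = z' t + z' (t - 1) + 1 := by
    intro t ht
    rw [Finset.mem_Icc] at ht
    rw [hz t ht.2, hz (t - 1) (by omega)]
  refine ⟨fun t ht => hz1 t ht ▸ H.1 t ht, ?_⟩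
  rw [← H.2, Finset.filter_congr fun t ht => by rw [← hz1 t ht]]

lemma HitsMaxAt.of_succ {h p x : ℕ} {z : ℕ → ℕ} (H : HitsMaxAt h p (x + 1) z)
    (hz : z x + z (x + 1) + 1 ≠ h) : HitsMaxAt h p x z := by
  refine ⟨fun t ht => H.1 t (Finset.Icc_subset_Icc_right (Nat.le_succ x) ht), ?_⟩
  rw [← H.2, ← Finset.insert_Icc_right_eq_Icc_add_one (by omega), Finset.filter_insert, if_neg]
  simp only [Nat.add_sub_cancel]
  omega

/-- The level `h` cannot be hit for the `p`-th time at two different times. -/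
lemma HitsMaxAt.not_lt {h p x y : ℕ} {z : ℕ → ℕ} (Hx : HitsMaxAt h p (x + 1) z)
    (Hy : HitsMaxAt h p (y + 1) z) (hy : z y + z (y + 1) + 1 = h) : ¬ x < y := by
  intro hxy
  refine absurd (Hx.2.trans Hy.2.symm) (ne_of_lt (Finset.card_lt_card ?_))
  refine Finset.ssubset_iff_of_subset (Finset.filter_subset_filter _
    (Finset.Icc_subset_Icc_right (by omega))) |>.2 ⟨y + 1, ?_, ?_⟩
  · simp only [Finset.mem_filter, Finset.mem_Icc, Nat.add_sub_cancel]
    omega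
  · simp only [Finset.mem_filter, Finset.mem_Icc]
    omega

lemma mem_eventB_iff {Ω : Type*} (Z : ℕ → Ω → ℕ) (x h p : ℕ) (ω : Ω) :
    ω ∈ eventB Z (x + 1) h p ↔ HitsMaxAt h p x fun t => Z t ω := by
  unfold eventB HitsMaxAt
  split_ifs with hp
  · subst hp
    simp only [Set.mem_ofPred_eq, tauTil, le_sInf_iff, Set.forall_mem_image, Nat.cast_le,
      Finset.card_eq_zero, Finset.filter_eq_empty_iff, Finset.mem_Icc, Ztil]
    constructor
    · intro H
      refine ⟨fun t ht => ?_, fun t ht he => ?_⟩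
      · by_contra hc
        have := H ⟨ht.1, by omega⟩
        omega
      · have := H ⟨ht.1, he.ge⟩
        omega
    · rintro ⟨H1, H2⟩ t ⟨ht1, ht2⟩
      by_contra hc
      have h1 := H1 t (by omega)
      exact H2 (x := t) (by omega) (by omega)
  · have hset : {t : ℕ | 1 ≤ t ∧ t < x + 1 ∧ Ztil Z t ω = h}
        = ((Finset.Icc 1 x).filter fun t => Z t ω + Z (t - 1) ω + 1 = h : Finset ℕ) := by
      ext t
      simp only [Set.mem_ofPred_eq, Ztil, Finset.coe_filter, Finset.mem_Icc]
      omega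
    rw [Set.mem_ofPred_eq, hset, Set.encard_coe_eq_coe_finsetCard, Nat.cast_inj]
    simp only [Finset.mem_Icc, Ztil, Nat.lt_succ_iff, and_imp]

lemma measurableSet_hitsMaxAt {Ω : Type*} [MeasurableSpace Ω] {Z : ℕ → Ω → ℕ}
    (hZ : ∀ t, Measurable (Z t)) (h p x : ℕ) :
    MeasurableSet {ω | HitsMaxAt h p x fun t => Z t ω} := by
  have hW : Measurable (fun ω => fun t : Fin (x + 1) => Z t ω) :=
    measurable_pi_lambda _ fun t => hZ t
  convert hW (MeasurableSet.of_discrete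
    (s := {w | HitsMaxAt h p x fun t => w (Fin.ofNat (x + 1) t)})) using 1
  ext ω
  have : ∀ t ≤ x, Z t ω = Z (Fin.ofNat (x + 1) t) ω := fun t ht => by
    simp [Nat.mod_eq_of_lt (Nat.lt_succ_of_le ht)]
  exact ⟨fun H => H.congr this, fun H => H.congr fun t ht => (this t ht).symm⟩

open scoped Classical in
/-- One step of the drift inequality, before the next hit of level `h`. -/
lemma measure_hitsMaxAt_add_lintegral_le {Ω : Type*} [MeasurableSpace Ω] {P : Measure Ω}
    {Z : ℕ → Ω → ℕ} {k : ℕ} (hZ : IsMarkovChainFrom P Z rho k) {h : ℕ} (hh : 1 ≤ h) (p x : ℕ) :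
    P {ω | HitsMaxAt h p x fun t => Z t ω} +
        ∫⁻ ω, (if HitsMaxAt h p x (fun t => Z t ω) ∧ Z x ω + Z (x + 1) ω + 1 < h
          then ENNReal.ofReal (lyapunov h (Z (x + 1) ω)) else 0) ∂P
      ≤ ∫⁻ ω in {ω | HitsMaxAt h p x fun t => Z t ω},
          ENNReal.ofReal (lyapunov h (Z x ω)) ∂P := by
  have hm := measurableSet_hitsMaxAt hZ.1 h p x
  have hext : ∀ ω, HitsMaxAt h p x (fun t => Z (Fin.ofNat (x + 1) t) ω)
      ↔ HitsMaxAt h p x (fun t => Z t ω) := by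
    intro ω
    have : ∀ t ≤ x, Z t ω = Z (Fin.ofNat (x + 1) t) ω := fun t ht => by
      simp [Nat.mod_eq_of_lt (Nat.lt_succ_of_le ht)]
    exact ⟨fun H => H.congr fun t ht => (this t ht).symm, fun H => H.congr this⟩
  have hmarkov := hZ.lintegral_path_next rho_nonneg x fun w j =>
    if HitsMaxAt h p x (fun t => w (Fin.ofNat (x + 1) t)) ∧ w (Fin.last x) + j + 1 < h
      then ENNReal.ofReal (lyapunov h j) else 0
  simp only [hext, Fin.val_last] at hmarkov
  rw [hmarkov, ← lintegral_indicator_one hm, ← lintegral_indicator hm,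
    ← lintegral_add_left (measurable_one.indicator hm)]
  refine lintegral_mono fun ω => ?_
  by_cases H : HitsMaxAt h p x fun t => Z t ω
  · simpa [Set.indicator, H] using lyapunov_supersolution hh (Z x ω)
  · simp [Set.indicator, H]

lemma tsum_measure_hitsMaxAt_le {Ω : Type*} [MeasurableSpace Ω] {P : Measure Ω}
    [IsProbabilityMeasure P] {Z : ℕ → Ω → ℕ} {k : ℕ} (hZ : IsMarkovChainFrom P Z rho k)
    {h : ℕ} (hh : 1 ≤ h) (p : ℕ) :
    ∑' x, P {ω | HitsMaxAt h p x fun t => Z t ω} ≤ ENNReal.ofReal (34 * h) := by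
  classical
  set B : ℕ → Set Ω := fun x => {ω | HitsMaxAt h p x fun t => Z t ω} with hB
  set A : ℕ → Set Ω := fun x => B (x + 1) ∩ {ω | Z x ω + Z (x + 1) ω + 1 = h} with hA
  set M : ℝ≥0∞ := ENNReal.ofReal (17 * h) with hM
  set a : ℕ → ℝ≥0∞ := fun x => ∫⁻ ω in B x, ENNReal.ofReal (lyapunov h (Z x ω)) ∂P with ha
  have hBm : ∀ x, MeasurableSet (B x) := measurableSet_hitsMaxAt hZ.1 h p
  have hAm : ∀ x, MeasurableSet (A x) := fun x => (hBm _).inter <|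
    (((hZ.1 x).add (hZ.1 (x + 1))).add_const 1) (measurableSet_singleton h)
  have hgM : ∀ i, ENNReal.ofReal (lyapunov h i) ≤ M := fun i =>
    ENNReal.ofReal_le_ofReal (lyapunov_le hh i)
  have hdisj : Pairwise (Function.onFun Disjoint A) := by
    intro x y hxy
    refine Set.disjoint_left.2 fun ω hx hy => ?_
    rcases lt_or_gt_of_ne hxy with hlt | hlt
    · exact hx.1.not_lt hy.1 hy.2 hlt
    · exact hy.1.not_lt hx.1 hx.2 hlt
  have hAsum : ∑' x, P (A x) ≤ 1 := by
    rw [← measure_iUnion hdisj hAm]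
    exact prob_le_one
  have ha0 : a 0 ≤ M := by
    calc a 0 ≤ ∫⁻ _ in B 0, M ∂P := lintegral_mono fun ω => hgM _
      _ = M * P (B 0) := setLIntegral_const _ _
      _ ≤ M * 1 := by gcongr; exact prob_le_one
      _ = M := mul_one M
  have hstep : ∀ x, P (B x) + a (x + 1) ≤ a x + M * P (A x) := by
    intro x
    calc P (B x) + a (x + 1)
        ≤ P (B x) + (∫⁻ ω, (if HitsMaxAt h p x (fun t => Z t ω) ∧ Z x ω + Z (x + 1) ω + 1 < h
          then ENNReal.ofReal (lyapunov h (Z (x + 1) ω)) else 0) ∂P + M * P (A x)) := by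
          gcongr
          rw [← lintegral_indicator_const (hAm x),
            ← lintegral_add_right _ (measurable_const.indicator (hAm x))]
          change ∫⁻ ω in B (x + 1), ENNReal.ofReal (lyapunov h (Z (x + 1) ω)) ∂P ≤ _
          rw [← lintegral_indicator (hBm _)]
          refine lintegral_mono fun ω => ?_
          by_cases hω : ω ∈ B (x + 1)
          swap
          · rw [Set.indicator_of_notMem hω]
            exact zero_le
          rw [Set.indicator_of_mem hω]
          by_cases hz : Z x ω + Z (x + 1) ω + 1 = h
          · have hωA : ω ∈ A x := ⟨hω, hz⟩
            simpa [Set.indicator_of_mem hωA] using (hgM _).trans le_add_self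
          · have hlt : Z x ω + Z (x + 1) ω + 1 < h := by
              have := hω.1 (x + 1) (by simp)
              simp only [Nat.add_sub_cancel] at this
              omega
            have hx : HitsMaxAt h p x fun t => Z t ω := HitsMaxAt.of_succ hω hz
            simp [hx, hlt]
      _ ≤ a x + M * P (A x) := by
          rw [← add_assoc]
          gcongr
          exact measure_hitsMaxAt_add_lintegral_le hZ hh p x
  have htel : ∀ N, ∑ x ∈ Finset.range N, P (B x) + a N
      ≤ a 0 + ∑ x ∈ Finset.range N, M * P (A x) := by
    intro N
    induction N with
    | zero => simp
    | succ N ih =>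
      rw [Finset.sum_range_succ, Finset.sum_range_succ, add_assoc]
      calc _ ≤ ∑ x ∈ Finset.range N, P (B x) + (a N + M * P (A N)) := by
            exact add_le_add_right (hstep N) _
        _ ≤ _ := by
            rw [← add_assoc, ← add_assoc]
            gcongr
  refine ENNReal.tsum_le_of_sum_range_le fun N => ?_
  calc _ ≤ a 0 + ∑ x ∈ Finset.range N, M * P (A x) := le_self_add.trans (htel N)
    _ ≤ M + M * 1 := by
        rw [← Finset.mul_sum]
        gcongr
        exact (ENNReal.sum_le_tsum _).trans hAsum
    _ = ENNReal.ofReal (34 * h) := by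
        rw [mul_one, hM, ← ENNReal.ofReal_add (by positivity) (by positivity)]
        congr 1
        ring

/-- For every ε > 0 there exists a finite constant C such that for all integers
h ≥ 1, k ≥ 0 and p ≥ 0, if the chain Z starts at k then
Σ_{x=1}^∞ P(B_{x,h,p}) ≤ C·h. -/
theorem stmt_2 :
    ∀ ε : ℝ, 0 < ε → ∃ C : ℝ,
      ∀ (h k p : ℕ), 1 ≤ h →
        ∀ (Ω : Type) (_ : MeasurableSpace Ω) (P : Measure Ω) (Z : ℕ → Ω → ℕ),
          IsProbabilityMeasure P → IsMarkovChainFrom P Z rho k →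
          ∑' x : ℕ, P (eventB Z (x + 1) h p) ≤ ENNReal.ofReal (C * h) := by
  intro _ _
  refine ⟨34, fun h k p hh Ω _ P Z _ hZ => ?_⟩
  have hB : ∀ x, eventB Z (x + 1) h p = {ω | HitsMaxAt h p x fun t => Z t ω} := fun x =>
    Set.ext fun ω => mem_eventB_iff Z x h p ω
  simpa only [hB] using tsum_measure_hitsMaxAt_le hZ hh p
end

section
/- For every ε > 0 there exists a finite constant C such that for all integers h ≥ 1, k ≥ 0 and p ≥ 0, if either k lies in the interval [(h − h^{1/2+ε})/2, (h + h^{1/2+ε})/2] or p ≥ 1, and the chain Z starts at k, then Σ_{x=1}^∞ P(B_{x,h,p}) ≤ (C·h^{−1/2+ε})^{p+1}·h. -/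
open MeasureTheory ProbabilityTheory
open scoped ENNReal

lemma rho_eq_choose (i j : ℕ) : rho i j = ((i + j).choose j : ℝ) / 2 ^ (i + j + 1) := by
  have hp : (2 : ℝ) ^ (-(i : ℝ) - (j : ℝ) - 1) = (2 ^ (i + j + 1))⁻¹ := by
    rw [← Real.rpow_natCast, ← Real.rpow_neg (by norm_num)]
    congr 1
    push_cast
    ring
  have hc : ((i + j).choose j : ℝ) * (i.factorial * j.factorial) = (i + j).factorial := by
    exact_mod_cast (mul_assoc _ _ _).symm.trans (Nat.add_choose_mul_factorial_mul_factorial i j)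
  rw [rho, hp, ← hc]
  have := Nat.factorial_ne_zero i
  have := Nat.factorial_ne_zero j
  field_simp

lemma rho_pos (i j : ℕ) : 0 < rho i j := by
  rw [rho]
  positivity

lemma rho_comm (i j : ℕ) : rho i j = rho j i := by
  rw [rho_eq_choose, rho_eq_choose, ← Nat.choose_symm_add, add_comm i j]

lemma rho_succ_right (i j : ℕ) :
    2 * ((j : ℝ) + 1) * rho i (j + 1) = ((i : ℝ) + j + 1) * rho i j := by
  have h : ((i + j : ℕ) + 1 : ℝ) * ((i + j).choose j : ℝ)
      = ((i + j + 1).choose (j + 1) : ℝ) * ((j : ℝ) + 1) := by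
    exact_mod_cast Nat.add_one_mul_choose_eq (i + j) j
  rw [rho_eq_choose, rho_eq_choose, ← add_assoc, pow_succ (2 : ℝ) (i + j + 1)]
  push_cast at h
  field_simp
  linarith

lemma hasSum_rho (i : ℕ) : HasSum (rho i) 1 := by
  have h := (hasSum_choose_mul_geometric_of_norm_lt_one i
    (r := (1 / 2 : ℝ)) (by norm_num)).mul_left ((1 / 2 : ℝ) ^ (i + 1))
  have h1 : (1 / 2 : ℝ) ^ (i + 1) * (1 / (1 - 1 / 2) ^ (i + 1)) = 1 := by
    norm_num
  rw [h1] at h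
  refine h.congr_fun ?_
  intro j
  rw [rho_eq_choose, ← Nat.choose_symm_add, add_comm i j, add_assoc j i 1, pow_add, one_div, inv_pow, inv_pow]
  field_simp

lemma sum_range_rho_le_one (i n : ℕ) : ∑ j ∈ Finset.range n, rho i j ≤ 1 :=
  sum_le_hasSum _ (fun j _ => rho_nonneg i j) (hasSum_rho i)

/-- Truncated first moment of a row of `rho`: the sum telescopes. -/
lemma sum_range_rho_mul (i b : ℕ) :
    ∑ j ∈ Finset.range b, rho i j * ((i : ℝ) + 1 - j) = 2 * b * rho i b := by
  induction b with
  | zero => simp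
  | succ b ih =>
    rw [Finset.sum_range_succ, ih]
    push_cast
    rw [rho_succ_right]
    ring

lemma rho_le_exp_mul (i j : ℕ) (l : ℝ) :
    rho i j ≤ Real.exp ((i + j : ℝ) * l ^ 2 / 2 - l * ((j : ℝ) - i)) := by
  have h1 : Real.exp (l * ((j : ℝ) - i)) * ((i + j).choose j : ℝ)
      ≤ (Real.exp l + Real.exp (-l)) ^ (i + j) := by
    rw [add_pow]
    refine le_trans (le_of_eq ?_) (Finset.single_le_sum
      (f := fun m => Real.exp l ^ m * Real.exp (-l) ^ (i + j - m) * ((i + j).choose m : ℝ))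
      (fun m _ => by positivity) (Finset.mem_range.2 (by omega : j < i + j + 1)))
    simp only [Nat.add_sub_cancel]
    rw [← Real.exp_nat_mul, ← Real.exp_nat_mul, ← Real.exp_add]
    congr 2
    ring
  have h2 : (Real.exp l + Real.exp (-l)) ^ (i + j)
      ≤ 2 ^ (i + j) * Real.exp ((i + j : ℝ) * l ^ 2 / 2) := by
    have h3 : Real.exp l + Real.exp (-l) = 2 * Real.cosh l := by
      rw [Real.cosh_eq]; ring
    have h4 : Real.exp ((i + j : ℝ) * l ^ 2 / 2) = Real.exp (l ^ 2 / 2) ^ (i + j) := by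
      rw [← Real.exp_nat_mul]
      push_cast
      congr 1
      ring
    rw [h3, mul_pow, h4]
    have := Real.cosh_pos l
    gcongr
    exact Real.cosh_le_exp_half_sq l
  rw [rho_eq_choose, Real.exp_sub, le_div_iff₀ (Real.exp_pos _), div_mul_eq_mul_div,
    div_le_iff₀ (by positivity), pow_succ (2 : ℝ)]
  have : 0 < (2 : ℝ) ^ (i + j) * Real.exp ((i + j : ℝ) * l ^ 2 / 2) := by positivity
  nlinarith

/-- Gaussian tail of `rho` on the antidiagonals below `h`. -/
lemma rho_le_exp_of_le_sub {h i j : ℕ} {d : ℝ} (hh : 1 ≤ h) (hd : 0 ≤ d) (hij : i + j < h)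
    (hdij : d ≤ (j : ℝ) - i) : rho i j ≤ Real.exp (-(d ^ 2 / (2 * h))) := by
  refine (rho_le_exp_mul i j (d / h)).trans (Real.exp_le_exp.2 ?_)
  have h0 : (0 : ℝ) < h := by exact_mod_cast hh
  have hn : ((i : ℝ) + j) ≤ h := by exact_mod_cast hij.le
  have h1 : (i + j : ℝ) * (d / h) ^ 2 / 2 ≤ h * (d / h) ^ 2 / 2 := by gcongr
  have h2 : d / h * d ≤ d / h * ((j : ℝ) - i) := by gcongr
  have h3 : (h : ℝ) * (d / h) ^ 2 / 2 - d / h * d = -(d ^ 2 / (2 * h)) := by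
    field_simp
    ring
  linarith

lemma rho_le_exp_of_le_abs {h i j : ℕ} {d : ℝ} (hh : 1 ≤ h) (hd : 0 ≤ d) (hij : i + j < h)
    (hdij : d ≤ |(j : ℝ) - i|) : rho i j ≤ Real.exp (-(d ^ 2 / (2 * h))) := by
  rcases le_abs.1 hdij with h1 | h1
  · exact rho_le_exp_of_le_sub hh hd hij h1
  · rw [rho_comm]
    exact rho_le_exp_of_le_sub hh hd (by omega) (by linarith)

/-- If moving right from `b` by at most `L` steps costs little, the mass of `rho i` on `[b, ∞)`
is at least `L / 2` times its value at `b`. -/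
lemma rho_le_mul_one_sub_sum {h i b : ℕ} {d L : ℝ} (hib : i + b + 1 = h)
    (hb : (b : ℝ) ≤ (h + d) / 2) (hd : 0 ≤ d) (hL : 0 < L) (hdL : L * (d + L + 2) ≤ h / 2) :
    rho i b ≤ 2 / L * (1 - ∑ j ∈ Finset.range b, rho i j) := by
  have hh : (h : ℝ) = i + b + 1 := by exact_mod_cast hib.symm
  have h0 : (0 : ℝ) < h := by rw [hh]; positivity
  set q : ℝ := (d + L + 2) / h with hq
  have hq0 : 0 ≤ q := by positivity
  have hLq : L * q ≤ 1 / 2 := by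
    rw [hq, ← mul_div_assoc, div_le_iff₀ h0]
    linarith
  have key : ∀ s : ℕ, (s : ℝ) ≤ L → (1 - s * q) * rho i b ≤ rho i (b + s) := by
    intro s
    induction s with
    | zero => simp
    | succ s ih =>
      intro hs
      push_cast at hs ⊢
      have ih' := ih (by linarith)
      have hrec := rho_succ_right i (b + s)
      push_cast at hrec
      have hs0 : (0 : ℝ) ≤ s := s.cast_nonneg
      have hsq : (s : ℝ) * q ≤ 1 / 2 := le_trans (by gcongr; linarith) hLq
      have hqh : q * h = d + L + 2 := by rw [hq]; field_simp
      have hb0 : (0 : ℝ) ≤ b := b.cast_nonneg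
      have hratio : (1 - q) * (2 * ((b : ℝ) + s + 1)) ≤ (i : ℝ) + (b + s) + 1 := by
        rcases le_total q 1 with h1 | h1
        · have : (1 - q) * (2 * ((b : ℝ) + s + 1)) ≤ (1 - q) * (h + d + 2 * s + 2) := by
            have : 0 ≤ 1 - q := by linarith
            gcongr
            linarith
          nlinarith [mul_nonneg hq0 hd, mul_nonneg hq0 hs0]
        · have : 0 ≤ (q - 1) * (2 * ((b : ℝ) + s + 1)) :=
            mul_nonneg (by linarith) (by positivity)
          nlinarith [(i.cast_nonneg : (0 : ℝ) ≤ i)]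
      have hc : (0 : ℝ) < 2 * ((b : ℝ) + s + 1) := by positivity
      have h5 : (1 - q) * rho i (b + s) ≤ rho i (b + s + 1) := by
        have := mul_le_mul_of_nonneg_right hratio (rho_nonneg i (b + s))
        rw [← hrec] at this
        nlinarith
      have hq1 : q ≤ 1 := by nlinarith
      have h6 := mul_le_mul_of_nonneg_left ih' (by linarith : 0 ≤ 1 - q)
      rw [← add_assoc]
      nlinarith [mul_nonneg (mul_nonneg hs0 (mul_nonneg hq0 hq0)) (rho_nonneg i b)]
  have hsum : ∑ j ∈ Finset.range b, rho i j
      + ∑ s ∈ Finset.range (⌊L⌋₊ + 1), rho i (b + s) ≤ 1 := by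
    rw [← Finset.sum_range_add]
    exact sum_range_rho_le_one i _
  have hlow : (⌊L⌋₊ + 1 : ℕ) • (rho i b / 2)
      ≤ ∑ s ∈ Finset.range (⌊L⌋₊ + 1), rho i (b + s) := by
    conv_lhs => rw [← Finset.card_range (⌊L⌋₊ + 1)]
    refine Finset.card_nsmul_le_sum _ _ _ fun s hs => ?_
    have hsL : (s : ℝ) ≤ L := by
      have : s ≤ ⌊L⌋₊ := Nat.lt_succ_iff.1 (Finset.mem_range.1 hs)
      exact (Nat.le_floor_iff hL.le).1 this
    have hsq : (s : ℝ) * q ≤ 1 / 2 := le_trans (by gcongr) hLq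
    refine le_trans ?_ (key s hsL)
    nlinarith [rho_pos i b]
  rw [nsmul_eq_mul] at hlow
  push_cast at hlow
  have hfl := (Nat.lt_floor_add_one L).le
  have h7 : L * (rho i b / 2) ≤ 1 - ∑ j ∈ Finset.range b, rho i j := by
    have : L * (rho i b / 2) ≤ ((⌊L⌋₊ : ℝ) + 1) * (rho i b / 2) := by
      have := rho_nonneg i b
      gcongr
    linarith
  rw [div_mul_eq_mul_div, le_div_iff₀ hL]
  linarith

/-- The first `x` consecutive pairs of the path `z` stay at level at most `h`, and exactly `p` of
them are at level `h`. -/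
def CappedWithHits (h x p : ℕ) (z : ℕ → ℕ) : Prop :=
  (∀ t < x, z t + z (t + 1) + 1 ≤ h) ∧
    (∑ t ∈ Finset.range x, if z t + z (t + 1) + 1 = h then 1 else 0) = p

lemma CappedWithHits.succ {h x p : ℕ} {z : ℕ → ℕ} (hz : CappedWithHits h (x + 1) p z) :
    (z 1 < h - 1 - z 0 ∧ CappedWithHits h x p fun t => z (t + 1)) ∨
      (z 0 < h ∧ z 1 = h - 1 - z 0 ∧
        ∃ q, p = q + 1 ∧ CappedWithHits h x q fun t => z (t + 1)) := by
  obtain ⟨h1, h2⟩ := hz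
  have h0 := h1 0 (by omega)
  have hs : ∀ t < x, z (t + 1) + z (t + 1 + 1) + 1 ≤ h := fun t ht => h1 (t + 1) (by omega)
  rw [Finset.sum_range_succ'] at h2
  simp only [zero_add] at h0 h2
  split_ifs at h2 with heq
  · exact Or.inr ⟨by omega, by omega, _, h2.symm, hs, rfl⟩
  · exact Or.inl ⟨by omega, hs, by simpa using h2⟩

lemma cappedWithHits_of_mem_eventB {Ω : Type*} {Z : ℕ → Ω → ℕ} {x h p : ℕ} {ω : Ω}
    (hω : ω ∈ eventB Z (x + 1) h p) : CappedWithHits h x p fun t => Z t ω := by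
  have hZ : ∀ t, Ztil Z (t + 1) ω = Z t ω + Z (t + 1) ω + 1 := by
    intro t
    simp only [Ztil, Nat.add_sub_cancel]
    omega
  rw [eventB] at hω
  split_ifs at hω with hp
  · have hlt : ∀ t < x, Z t ω + Z (t + 1) ω + 1 < h := by
      intro t ht
      by_contra hge
      have hle : tauTil Z h ω ≤ ((t + 1 : ℕ) : ℕ∞) :=
        sInf_le ⟨t + 1, ⟨by omega, by rw [hZ]; omega⟩, rfl⟩
      have := le_trans (show ((x + 1 : ℕ) : ℕ∞) ≤ tauTil Z h ω from hω) hle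
      have : x + 1 ≤ t + 1 := by exact_mod_cast this
      omega
    refine ⟨fun t ht => (hlt t ht).le, ?_⟩
    rw [hp]
    refine Finset.sum_eq_zero fun t ht => if_neg ?_
    exact (hlt t (Finset.mem_range.1 ht)).ne
  · obtain ⟨hle, hcard⟩ := hω
    refine ⟨fun t ht => hZ t ▸ hle (t + 1) (by omega) (by omega), ?_⟩
    have hset : {t : ℕ | 1 ≤ t ∧ t < x + 1 ∧ Ztil Z t ω = h} = (fun t => t + 1) ''
        (((Finset.range x).filter fun t => Z t ω + Z (t + 1) ω + 1 = h : Finset ℕ) : Set ℕ) := by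
      ext t
      simp only [Set.mem_ofPred_eq, Set.mem_image, Finset.coe_filter, Finset.mem_range]
      constructor
      · rintro ⟨h1, h2, h3⟩
        obtain ⟨s, rfl⟩ := Nat.exists_eq_add_of_le' h1
        exact ⟨s, ⟨by omega, by rw [← hZ]; exact h3⟩, rfl⟩
      · rintro ⟨s, ⟨h1, h2⟩, rfl⟩
        exact ⟨by omega, by omega, by rw [hZ]; exact h2⟩
    rw [hset, Function.Injective.encard_image (add_left_injective 1),
      Set.encard_coe_eq_coe_finsetCard] at hcard
    rw [← Finset.card_filter]
    exact_mod_cast hcard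

namespace IsMarkovChainFrom

variable {Ω : Type*} [MeasurableSpace Ω] {P : Measure Ω} {Z : ℕ → Ω → ℕ} {k : ℕ}

lemma measure_prefix_succ (hZ : IsMarkovChainFrom P Z rho k) (n : ℕ) (ks : ℕ → ℕ) (j : ℕ) :
    P {ω | ∀ i ≤ n + 1, Z i ω = Function.update ks (n + 1) j i} =
      P {ω | ∀ i ≤ n, Z i ω = ks i} * ENNReal.ofReal (rho (ks n) j) := by
  have hprod : ∏ i ∈ Finset.range n, rho (Function.update ks (n + 1) j i)
      (Function.update ks (n + 1) j (i + 1)) =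
      ∏ i ∈ Finset.range n, rho (ks i) (ks (i + 1)) := by
    refine Finset.prod_congr rfl fun i hi => ?_
    have := Finset.mem_range.1 hi
    rw [Function.update_of_ne (by omega), Function.update_of_ne (by omega)]
  rw [hZ.2, hZ.2, Finset.prod_range_succ, hprod, Function.update_self,
    Function.update_of_ne (by omega), Function.update_of_ne (by omega), ← mul_assoc,
    ENNReal.ofReal_mul]
  refine mul_nonneg (by split_ifs <;> norm_num) (Finset.prod_nonneg fun i _ => rho_nonneg _ _)

/-- Supersolutions of the first-step equations bound the expected number of `x` for which the path
is capped at `h` with `p` hits, given any prefix. -/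
lemma sum_measure_prefix_inter_le (hZ : IsMarkovChainFrom P Z rho k) {h : ℕ} {w : ℕ → ℕ → ℝ≥0∞}
    (hw₀ : ∀ i, 1 + ∑ j ∈ Finset.range (h - 1 - i), ENNReal.ofReal (rho i j) * w 0 j ≤ w 0 i)
    (hw : ∀ p i, (if i < h then ENNReal.ofReal (rho i (h - 1 - i)) * w p (h - 1 - i) else 0)
      + ∑ j ∈ Finset.range (h - 1 - i), ENNReal.ofReal (rho i j) * w (p + 1) j ≤ w (p + 1) i)
    (N n : ℕ) (ks : ℕ → ℕ) (p : ℕ) :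
    ∑ x ∈ Finset.range N, P ({ω | ∀ i ≤ n, Z i ω = ks i} ∩
        {ω | CappedWithHits h x p fun t => Z (n + t) ω}) ≤
      P {ω | ∀ i ≤ n, Z i ω = ks i} * w p (ks n) := by
  induction N generalizing n ks p with
  | zero => simp
  | succ N ih =>
    set A : Set Ω := {ω | ∀ i ≤ n, Z i ω = ks i} with hA
    set U : ℕ → Set Ω := fun j => {ω | ∀ i ≤ n + 1, Z i ω = Function.update ks (n + 1) j i}
      with hU
    set E : ℕ → ℕ → Set Ω := fun x p => {ω | CappedWithHits h x p fun t => Z (n + 1 + t) ω}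
      with hE
    have hAU : ∀ ω ∈ A, ω ∈ U (Z (n + 1) ω) := by
      intro ω hω i hi
      rcases Nat.lt_or_ge n i with h1 | h1
      · obtain rfl : i = n + 1 := by omega
        rw [Function.update_self]
      · rw [Function.update_of_ne (by omega)]
        exact hω i h1
    have hstep : ∀ j q, ∑ x ∈ Finset.range N, P (U j ∩ E x q) ≤
        P A * (ENNReal.ofReal (rho (ks n) j) * w q j) := by
      intro j q
      refine (ih (n + 1) (Function.update ks (n + 1) j) q).trans (le_of_eq ?_)
      rw [hZ.measure_prefix_succ, Function.update_self, mul_assoc]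
    have hsucc : ∀ x ω, ω ∈ A → CappedWithHits h (x + 1) p (fun t => Z (n + t) ω) →
        (ω ∈ ⋃ j ∈ Finset.range (h - 1 - ks n), U j ∩ E x p) ∨
          (ks n < h ∧ ∃ q, p = q + 1 ∧ ω ∈ U (h - 1 - ks n) ∩ E x q) := by
      intro x ω hω hc
      have hn : Z n ω = ks n := hω n le_rfl
      have hshift : (fun t => Z (n + (t + 1)) ω) = fun t => Z (n + 1 + t) ω := by
        funext t
        rw [add_assoc, add_comm 1 t]
      have := hc.succ
      rw [hshift] at this
      simp only [add_zero, hn] at this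
      rcases this with ⟨h1, h2⟩ | ⟨h1, h2, q, hq, h3⟩
      · exact Or.inl (Set.mem_biUnion (Finset.mem_coe.2 (Finset.mem_range.2 h1)) ⟨hAU ω hω, h2⟩)
      · exact Or.inr ⟨h1, q, hq, h2 ▸ hAU ω hω, h3⟩
    have hbelow : ∑ x ∈ Finset.range N, P (⋃ j ∈ Finset.range (h - 1 - ks n), U j ∩ E x p) ≤
        P A * ∑ j ∈ Finset.range (h - 1 - ks n), ENNReal.ofReal (rho (ks n) j) * w p j := by
      refine (Finset.sum_le_sum fun x _ => measure_biUnion_finset_le _ _).trans ?_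
      rw [Finset.sum_comm, Finset.mul_sum]
      exact Finset.sum_le_sum fun j _ => hstep j p
    rw [Finset.sum_range_succ']
    cases p with
    | zero =>
      have h1 : ∀ x, P (A ∩ {ω | CappedWithHits h (x + 1) 0 fun t => Z (n + t) ω}) ≤
          P (⋃ j ∈ Finset.range (h - 1 - ks n), U j ∩ E x 0) := by
        refine fun x => measure_mono fun ω hω => ?_
        rcases hsucc x ω hω.1 hω.2 with h1 | ⟨-, q, hq, -⟩
        · exact h1
        · omega
      calc _ ≤ P A * ∑ j ∈ Finset.range (h - 1 - ks n), ENNReal.ofReal (rho (ks n) j) * w 0 j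
            + P A := add_le_add ((Finset.sum_le_sum fun x _ => h1 x).trans hbelow)
              (measure_mono Set.inter_subset_left)
        _ = P A * (1 + ∑ j ∈ Finset.range (h - 1 - ks n),
              ENNReal.ofReal (rho (ks n) j) * w 0 j) := by ring
        _ ≤ _ := by gcongr; exact hw₀ _
    | succ p =>
      have h0 : A ∩ {ω | CappedWithHits h 0 (p + 1) fun t => Z (n + t) ω} = ∅ := by
        ext ω
        simp [CappedWithHits]
      have hhit : ∑ x ∈ Finset.range N, P {ω | ks n < h ∧ ω ∈ U (h - 1 - ks n) ∩ E x p} ≤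
          P A * (if ks n < h then
            ENNReal.ofReal (rho (ks n) (h - 1 - ks n)) * w p (h - 1 - ks n) else 0) := by
        split_ifs with hlt
        · simpa only [hlt, true_and, Set.ofPred_mem_eq] using hstep (h - 1 - ks n) p
        · simp [hlt]
      have h1 : ∀ x, P (A ∩ {ω | CappedWithHits h (x + 1) (p + 1) fun t => Z (n + t) ω}) ≤
          P {ω | ks n < h ∧ ω ∈ U (h - 1 - ks n) ∩ E x p} +
          P (⋃ j ∈ Finset.range (h - 1 - ks n), U j ∩ E x (p + 1)) := by
        refine fun x => (measure_mono fun ω hω => ?_).trans (measure_union_le _ _)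
        rcases hsucc x ω hω.1 hω.2 with h1 | ⟨h1, q, hq, h2⟩
        · exact Or.inr h1
        · obtain rfl : p = q := by omega
          exact Or.inl ⟨h1, h2⟩
      rw [h0, measure_empty, add_zero]
      refine (Finset.sum_le_sum fun x _ => h1 x).trans ?_
      rw [Finset.sum_add_distrib]
      refine (add_le_add hhit hbelow).trans ?_
      rw [← mul_add]
      gcongr
      exact hw _ _

/-- Real-valued form of the supersolution bound for the series of the statement. -/
lemma tsum_measure_eventB_le [IsProbabilityMeasure P] (hZ : IsMarkovChainFrom P Z rho k) {h : ℕ}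
    {w : ℕ → ℕ → ℝ} (hnn : ∀ p i, 0 ≤ w p i)
    (hw₀ : ∀ i, 1 + ∑ j ∈ Finset.range (h - 1 - i), rho i j * w 0 j ≤ w 0 i)
    (hw : ∀ p i, (if i < h then rho i (h - 1 - i) * w p (h - 1 - i) else 0)
      + ∑ j ∈ Finset.range (h - 1 - i), rho i j * w (p + 1) j ≤ w (p + 1) i) (p : ℕ) :
    ∑' x : ℕ, P (eventB Z (x + 1) h p) ≤ ENNReal.ofReal (w p k) := by
  have hsum : ∀ i p, ∑ j ∈ Finset.range (h - 1 - i),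
      ENNReal.ofReal (rho i j) * ENNReal.ofReal (w p j) =
      ENNReal.ofReal (∑ j ∈ Finset.range (h - 1 - i), rho i j * w p j) := by
    intro i p
    rw [ENNReal.ofReal_sum_of_nonneg fun j _ => mul_nonneg (rho_nonneg _ _) (hnn _ _)]
    exact Finset.sum_congr rfl fun j _ => (ENNReal.ofReal_mul (rho_nonneg _ _)).symm
  have hsum_nn : ∀ i p, 0 ≤ ∑ j ∈ Finset.range (h - 1 - i), rho i j * w p j := fun i p =>
    Finset.sum_nonneg fun j _ => mul_nonneg (rho_nonneg _ _) (hnn _ _)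
  have hstart : P {ω | ∀ i ≤ 0, Z i ω = k} = 1 := by
    simpa using hZ.2 0 fun _ => k
  have hmeas : MeasurableSet {ω | ∀ i ≤ 0, Z i ω = k} := by
    have : {ω | ∀ i ≤ 0, Z i ω = k} = Z 0 ⁻¹' {k} := by
      ext ω
      simp
    exact this ▸ hZ.1 0 (measurableSet_singleton k)
  have hnull : P {ω | ∀ i ≤ 0, Z i ω = k}ᶜ = 0 := (prob_compl_eq_zero_iff hmeas).2 hstart
  refine ENNReal.tsum_le_of_sum_range_le fun N => ?_
  have hmain := hZ.sum_measure_prefix_inter_le (h := h) (w := fun p i => ENNReal.ofReal (w p i))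
    (fun i => by
      rw [hsum, ← ENNReal.ofReal_one, ← ENNReal.ofReal_add zero_le_one (hsum_nn _ _)]
      exact ENNReal.ofReal_le_ofReal (hw₀ i))
    (fun p i => by
      refine le_trans (le_of_eq ?_) (ENNReal.ofReal_le_ofReal (hw p i))
      rw [hsum, ENNReal.ofReal_add _ (hsum_nn _ _)]
      · congr 1
        split_ifs
        · rw [ENNReal.ofReal_mul (rho_nonneg _ _)]
        · simp
      · split_ifs
        · exact mul_nonneg (rho_nonneg _ _) (hnn _ _)
        · rfl)
    N 0 (fun _ => k) p
  rw [hstart, one_mul] at hmain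
  refine le_trans (Finset.sum_le_sum fun x _ => ?_) hmain
  calc P (eventB Z (x + 1) h p)
      ≤ P (({ω | ∀ i ≤ 0, Z i ω = k} ∩ {ω | CappedWithHits h x p fun t => Z (0 + t) ω}) ∪
          {ω | ∀ i ≤ 0, Z i ω = k}ᶜ) := by
        refine measure_mono fun ω hω => ?_
        by_cases hk : ω ∈ {ω | ∀ i ≤ 0, Z i ω = k}
        · refine Or.inl ⟨hk, ?_⟩
          simpa only [Set.mem_ofPred_eq, zero_add] using cappedWithHits_of_mem_eventB hω
        · exact Or.inr hk
    _ ≤ _ := (measure_union_le _ _).trans (by rw [hnull, add_zero])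

end IsMarkovChainFrom

/-- The estimates on `rho` at level `h` and scale `D` used below: `η` bounds `rho` off the
diagonal, and `α` bounds the conditional probability of hitting level `h` exactly. -/
structure LevelEstimates (h : ℕ) (D α η : ℝ) : Prop where
  one_le_h : 1 ≤ h
  one_le_D : 1 ≤ D
  α_nonneg : 0 ≤ α
  η_nonneg : 0 ≤ η
  tail : ∀ i j, i + j < h → D ≤ |(j : ℝ) - i| → rho i j ≤ η
  ratio : ∀ i b, i + b + 1 = h → (b : ℝ) ≤ (h + D) / 2 →
    rho i b ≤ α * (1 - ∑ j ∈ Finset.range b, rho i j)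
  α_mul : α * h = 16 * D
  η_small : h * η * (6 * h + 66 * D + 2) ≤ 1

/-- A bound for the expected hitting time of level `h` started at `i`. -/
noncomputable def hitBound (h : ℕ) (D : ℝ) (i : ℕ) : ℝ := 2 * max (h / 2 + 33 * D - i) 0 + 2

lemma two_le_hitBound (h : ℕ) (D : ℝ) (i : ℕ) : 2 ≤ hitBound h D i := by
  have := le_max_right ((h : ℝ) / 2 + 33 * D - i) 0
  rw [hitBound]
  linarith

namespace LevelEstimates

variable {h : ℕ} {D α η : ℝ}

lemma hitBound_le (H : LevelEstimates h D α η) (i : ℕ) :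
    hitBound h D i ≤ h + 66 * D + 2 := by
  have := H.one_le_D
  have : max ((h : ℝ) / 2 + 33 * D - i) 0 ≤ h / 2 + 33 * D :=
    max_le (by linarith [(i.cast_nonneg : (0 : ℝ) ≤ i)]) (by positivity)
  rw [hitBound]
  linarith

lemma hitBound_le_of_le (H : LevelEstimates h D α η) {i : ℕ} {c : ℝ} (hc : 0 ≤ c)
    (hi : (h - D) / 2 - c ≤ (i : ℝ)) : hitBound h D i ≤ 69 * D + 2 * c := by
  have := H.one_le_D
  have : max ((h : ℝ) / 2 + 33 * D - i) 0 ≤ 33.5 * D + c :=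
    max_le (by linarith) (by linarith)
  rw [hitBound]
  linarith

/-- Exact hits of level `h` are either typical and rare, or atypical. -/
lemma rho_le (H : LevelEstimates h D α η) {i b : ℕ} (hib : i + b + 1 = h) :
    rho i b ≤ α * (1 - ∑ j ∈ Finset.range b, rho i j) + η := by
  have hh : (h : ℝ) = i + b + 1 := by exact_mod_cast hib.symm
  rcases le_total (b : ℝ) ((h + D) / 2) with hb | hb
  · linarith [H.ratio i b hib hb, H.η_nonneg]
  · have := H.tail i b (by omega) (le_abs.2 (Or.inl (by linarith)))
    have := mul_nonneg H.α_nonneg (sub_nonneg.2 (sum_range_rho_le_one i b))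
    linarith

lemma hitBound_supersolution (H : LevelEstimates h D α η) (i : ℕ) :
    1 + ∑ j ∈ Finset.range (h - 1 - i), rho i j * hitBound h D j ≤ hitBound h D i := by
  have hD := H.one_le_D
  have hη := H.η_nonneg
  have hsmall := H.η_small
  have hi2 := two_le_hitBound h D i
  have hh0 : (1 : ℝ) ≤ h := by exact_mod_cast H.one_le_h
  rcases Nat.lt_or_ge i h with hih | hih
  swap
  · have : h - 1 - i = 0 := by omega
    rw [this, Finset.sum_range_zero]
    linarith
  obtain ⟨b, hib⟩ : ∃ b, i + b + 1 = h := ⟨h - 1 - i, by omega⟩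
  have hbe : h - 1 - i = b := by omega
  have hh : (h : ℝ) = i + b + 1 := by exact_mod_cast hib.symm
  have hi0 : (0 : ℝ) ≤ i := i.cast_nonneg
  have hb0 : (0 : ℝ) ≤ b := b.cast_nonneg
  rw [hbe]
  rcases le_total ((h : ℝ) / 2 + D) i with hi | hi
  · have hle : ∀ j ∈ Finset.range b, rho i j * hitBound h D j ≤ η * (h + 66 * D + 2) := by
      intro j hj
      have hjb := Finset.mem_range.1 hj
      have hjb' : (j : ℝ) ≤ b := by exact_mod_cast hjb.le
      have h2 := two_le_hitBound h D j
      exact mul_le_mul (H.tail i j (by omega) (le_abs.2 (Or.inr (by linarith))))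
        (H.hitBound_le j) (by linarith) hη
    have hsum := Finset.sum_le_card_nsmul _ _ _ hle
    rw [Finset.card_range, nsmul_eq_mul] at hsum
    have : (b : ℝ) * (η * (h + 66 * D + 2)) ≤ h * (η * (6 * h + 66 * D + 2)) := by
      gcongr <;> linarith
    linarith
  · set F := ∑ j ∈ Finset.range b, rho i j with hF
    have hF1 : F ≤ 1 := sum_range_rho_le_one i b
    set A : ℝ := h / 2 + 33 * D with hA
    have hle : ∀ j ∈ Finset.range b, rho i j * hitBound h D j ≤
        2 * (rho i j * ((i : ℝ) + 1 - j)) + (2 * (A - i - 1) + 2) * rho i j + 2 * (h * η) := by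
      intro j hj
      have hjb := Finset.mem_range.1 hj
      have hjb' : (j : ℝ) + 1 ≤ b := by exact_mod_cast hjb
      have hρ := rho_nonneg i j
      rw [hitBound, ← hA]
      rcases le_total (j : ℝ) A with hjA | hjA
      · rw [max_eq_left (by linarith)]
        have : 0 ≤ h * η := by positivity
        linarith
      · rw [max_eq_right (by linarith)]
        have ht := H.tail i j (by omega) (le_abs.2 (Or.inl (by linarith)))
        have : (j - A) * rho i j ≤ h * η :=
          mul_le_mul (by linarith) ht hρ (by linarith)
        linarith
    have hsum := Finset.sum_le_sum hle
    rw [Finset.sum_add_distrib, Finset.sum_add_distrib, ← Finset.mul_sum, ← Finset.mul_sum,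
      sum_range_rho_mul, ← hF, Finset.sum_const, Finset.card_range, nsmul_eq_mul] at hsum
    have hbh : (b : ℝ) * (2 * (h * η)) ≤ h * (2 * (h * η)) := by
      gcongr
      linarith
    have hr : 4 * b * rho i b ≤ 64 * D * (1 - F) + 4 * (h * η) := by
      have h1 := H.rho_le hib
      have h2 : 4 * b * rho i b ≤ 4 * h * rho i b := by
        have := rho_nonneg i b
        gcongr
        linarith
      have h3 : 4 * h * rho i b ≤ 4 * h * (α * (1 - F) + η) := by gcongr
      have h4 : 4 * h * (α * (1 - F) + η) = 4 * (α * h) * (1 - F) + 4 * (h * η) := by ring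
      rw [h4, H.α_mul] at h3
      linarith
    have hg : hitBound h D i = 2 * (A - i) + 2 := by
      rw [hitBound, max_eq_left (by linarith)]
    have hAi : 64 * D * (1 - F) ≤ (2 * (A - i - 1) + 2) * (1 - F) := by
      have : 0 ≤ 1 - F := by linarith
      gcongr
      linarith
    have hDη : h * η * (6 * h) ≤ 1 := by
      have : 0 ≤ h * η * (66 * D + 2) := by positivity
      linarith
    have hηh : h * η ≤ h * η * h := le_mul_of_one_le_right (by positivity) hh0
    rw [hg]
    linarith

/-- Bounds for the expected number of `x` at which the path is capped at `h` with `p` hits. -/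
noncomputable def capBound (h : ℕ) (D α η : ℝ) : ℕ → ℕ → ℝ
  | 0, i => hitBound h D i
  | 1, i => 71 * α * D + η * (h + 66 * D + 2) * hitBound h D i
  | p + 2, i => (71 * α * D + η * (h + 66 * D + 2) ^ 2) * (α + η * (h + 66 * D + 2)) ^ p *
      (α + η * hitBound h D i)

lemma capBound_nonneg (H : LevelEstimates h D α η) (p i : ℕ) : 0 ≤ capBound h D α η p i := by
  have hD := H.one_le_D
  have hη := H.η_nonneg
  have hα := H.α_nonneg
  have hg : 0 ≤ hitBound h D i := by linarith [two_le_hitBound h D i]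
  match p with
  | 0 => exact hg
  | 1 => rw [capBound]; positivity
  | p + 2 => rw [capBound]; positivity

lemma capBound_succ_le (H : LevelEstimates h D α η) (p i : ℕ) :
    capBound h D α η (p + 1) i ≤
      (71 * α * D + η * (h + 66 * D + 2) ^ 2) * (α + η * (h + 66 * D + 2)) ^ p := by
  have hD := H.one_le_D
  have hη := H.η_nonneg
  have hα := H.α_nonneg
  have hg := H.hitBound_le i
  match p with
  | 0 =>
    rw [capBound, pow_zero, mul_one, pow_two, ← mul_assoc]
    gcongr
  | p + 1 =>
    rw [capBound, pow_succ _ p, ← mul_assoc]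
    gcongr

/-- An affine function `c + d * hitBound` is a supersolution as soon as it dominates the source
term. -/
lemma affine_supersolution (H : LevelEstimates h D α η) {c d : ℝ} (hc : 0 ≤ c) (hd : 0 ≤ d)
    {i : ℕ} {s : ℕ → ℝ}
    (hs : ∀ b, i + b + 1 = h → rho i b * s b ≤ c * (1 - ∑ j ∈ Finset.range b, rho i j) + d) :
    (if i < h then rho i (h - 1 - i) * s (h - 1 - i) else 0)
      + ∑ j ∈ Finset.range (h - 1 - i), rho i j * (c + d * hitBound h D j) ≤
      c + d * hitBound h D i := by
  have hsum : ∑ j ∈ Finset.range (h - 1 - i), rho i j * (c + d * hitBound h D j) =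
      c * ∑ j ∈ Finset.range (h - 1 - i), rho i j +
      d * ∑ j ∈ Finset.range (h - 1 - i), rho i j * hitBound h D j := by
    rw [Finset.mul_sum, Finset.mul_sum, ← Finset.sum_add_distrib]
    exact Finset.sum_congr rfl fun j _ => by ring
  have hg := mul_le_mul_of_nonneg_left (H.hitBound_supersolution i) hd
  have hF := mul_le_mul_of_nonneg_left (sum_range_rho_le_one i (h - 1 - i)) hc
  rw [hsum]
  split_ifs with hi
  · have := hs (h - 1 - i) (by omega)
    linarith
  · linarith

lemma capBound_supersolution (H : LevelEstimates h D α η) (p i : ℕ) :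
    (if i < h then rho i (h - 1 - i) * capBound h D α η p (h - 1 - i) else 0)
      + ∑ j ∈ Finset.range (h - 1 - i), rho i j * capBound h D α η (p + 1) j ≤
      capBound h D α η (p + 1) i := by
  have hD := H.one_le_D
  have hη := H.η_nonneg
  have hα := H.α_nonneg
  match p with
  | 0 =>
    simp only [capBound]
    refine H.affine_supersolution (by positivity) (by positivity) fun b hib => ?_
    have hh : (h : ℝ) = i + b + 1 := by exact_mod_cast hib.symm
    have hF := sub_nonneg.2 (sum_range_rho_le_one i b)
    have hg2 := two_le_hitBound h D b
    have hg := H.hitBound_le b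
    have hrare : D ≤ |(b : ℝ) - i| → rho i b * hitBound h D b ≤
        71 * α * D * (1 - ∑ j ∈ Finset.range b, rho i j) + η * (h + 66 * D + 2) := by
      intro hbi
      have h1 := mul_le_mul (H.tail i b (by omega) hbi) hg (by linarith) hη
      have h2 : 0 ≤ 71 * α * D * (1 - ∑ j ∈ Finset.range b, rho i j) := by positivity
      linarith
    rcases le_total (b : ℝ) ((h + D) / 2) with hb | hb
    · rcases le_total ((h - D) / 2 - 1) (b : ℝ) with hb' | hb'
      · have h1 := mul_le_mul (H.ratio i b hib hb) (H.hitBound_le_of_le zero_le_one hb')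
          (by linarith) (by positivity)
        have h2 : 0 ≤ η * (h + 66 * D + 2) := by positivity
        have h3 : α * (1 - ∑ j ∈ Finset.range b, rho i j) * (69 * D + 2 * 1) ≤
            α * (1 - ∑ j ∈ Finset.range b, rho i j) * (71 * D) := by
          gcongr
          linarith
        linarith
      · exact hrare (le_abs.2 (Or.inr (by linarith)))
    · exact hrare (le_abs.2 (Or.inl (by linarith)))
  | p + 1 =>
    set M := (71 * α * D + η * (h + 66 * D + 2) ^ 2) * (α + η * (h + 66 * D + 2)) ^ p with hM
    have hM0 : 0 ≤ M := by positivity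
    have hcap : ∀ j, capBound h D α η (p + 1 + 1) j = M * α + M * η * hitBound h D j := by
      intro j
      rw [capBound, ← hM]
      ring
    simp only [hcap]
    refine H.affine_supersolution (by positivity) (by positivity) fun b hib => ?_
    have h1 := mul_le_mul (H.rho_le hib) (H.capBound_succ_le p b) (H.capBound_nonneg _ _)
      (add_nonneg (mul_nonneg hα (sub_nonneg.2 (sum_range_rho_le_one i b))) hη)
    linarith

end LevelEstimates

lemma LevelEstimates.of_small {h : ℕ} {r η : ℝ} (hh : 1 ≤ h) (hD : 1 ≤ r * h)
    (hr : 1 ≤ r ^ 2 * h) (hη : η = Real.exp (-((r * h) ^ 2 / (2 * h))))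
    (hsmall : h * η * (6 * h + 66 * (r * h) + 2) ≤ 1) :
    LevelEstimates h (r * h) (16 * r) η := by
  have h0 : (1 : ℝ) ≤ h := by exact_mod_cast hh
  have hr0 : 0 < r := pos_of_mul_pos_left (by linarith) (by linarith : (0 : ℝ) ≤ h)
  refine ⟨hh, hD, by positivity, hη ▸ (Real.exp_pos _).le, fun i j hij hd => ?_,
    fun i b hib hb => ?_, by ring, hsmall⟩
  · rw [hη]
    exact rho_le_exp_of_le_abs hh (by linarith) hij hd
  · have hL : (16 * r) = 2 / (1 / (8 * r)) := by
      field_simp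
      norm_num
    rw [hL]
    refine rho_le_mul_one_sub_sum hib hb (by linarith) (by positivity) ?_
    have h1 : 1 / (8 * r) ≤ h / 8 := by
      rw [div_le_div_iff₀ (by positivity) (by norm_num)]
      linarith
    have h2 : 1 / (8 * r) * (1 / (8 * r)) ≤ h / 64 := by
      rw [div_mul_div_comm, div_le_div_iff₀ (by positivity) (by norm_num)]
      linarith
    have h3 : 1 / (8 * r) * (r * h) = h / 8 := by field_simp
    rw [mul_add, mul_add, h3]
    linarith

lemma IsMarkovChainFrom.tsum_measure_eventB_le_two_pow {Ω : Type*} [MeasurableSpace Ω]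
    {P : Measure Ω} {Z : ℕ → Ω → ℕ} {k : ℕ} [IsProbabilityMeasure P]
    (hZ : IsMarkovChainFrom P Z rho k) (h p : ℕ) :
    ∑' x : ℕ, P (eventB Z (x + 1) h p) ≤ ENNReal.ofReal (2 ^ h) := by
  have h2 : (1 : ℝ) ≤ 2 ^ h := one_le_pow₀ (by norm_num)
  have hle : ∀ i, i < h →
      rho i (h - 1 - i) + ∑ j ∈ Finset.range (h - 1 - i), rho i j ≤ 1 := by
    intro i hi
    rw [add_comm, ← Finset.sum_range_succ]
    exact sum_range_rho_le_one i _
  have hlow : ∀ i, i < h → 1 ≤ 2 ^ h * rho i (h - 1 - i) := by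
    intro i hi
    have hc : (1 : ℝ) ≤ (i + (h - 1 - i)).choose (h - 1 - i) := by
      exact_mod_cast Nat.choose_pos (Nat.le_add_left _ _)
    rw [rho_eq_choose, show i + (h - 1 - i) + 1 = h by omega, mul_div_cancel₀ _ (by positivity)]
    exact hc
  refine hZ.tsum_measure_eventB_le (w := fun _ _ => 2 ^ h) (fun _ _ => by positivity)
    (fun i => ?_) (fun _ i => ?_) p
  · rw [← Finset.sum_mul]
    rcases Nat.lt_or_ge i h with hi | hi
    · nlinarith [hle i hi, hlow i hi]
    · simpa [show h - 1 - i = 0 by omega] using h2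
  · rw [← Finset.sum_mul]
    split_ifs with hi
    · nlinarith [hle i hi]
    · nlinarith [sum_range_rho_le_one i (h - 1 - i)]

lemma eventually_rpow_mul_exp_le {ε : ℝ} (hε : 0 < ε) :
    ∀ᶠ h : ℕ in Filter.atTop,
      5000 * (h : ℝ) ^ (3 + 3 * ε) * Real.exp (-((h : ℝ) ^ (2 * ε) / 2)) ≤ 1 := by
  have h1 := tendsto_rpow_mul_exp_neg_mul_atTop_nhds_zero ((3 + 3 * ε) / (2 * ε)) (1 / 2)
    (by norm_num)
  have h2 : Filter.Tendsto (fun h : ℕ => (h : ℝ) ^ (2 * ε)) Filter.atTop Filter.atTop :=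
    (tendsto_rpow_atTop (by positivity)).comp tendsto_natCast_atTop_atTop
  filter_upwards [(h1.comp h2).eventually (ge_mem_nhds (by norm_num : (0 : ℝ) < 1 / 5000))]
    with h hh
  simp only [Function.comp_apply] at hh
  rw [← Real.rpow_mul h.cast_nonneg, mul_div_cancel₀ _ (by positivity),
    show -(1 / 2) * (h : ℝ) ^ (2 * ε) = -((h : ℝ) ^ (2 * ε) / 2) by ring] at hh
  linarith

lemma IsMarkovChainFrom.tsum_measure_eventB_le_of_small {Ω : Type*} [MeasurableSpace Ω]
    {P : Measure Ω} {Z : ℕ → Ω → ℕ} {k : ℕ} [IsProbabilityMeasure P]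
    (hZ : IsMarkovChainFrom P Z rho k) {h p : ℕ} {r η C : ℝ}
    (H : LevelEstimates h (r * h) (16 * r) η) (hr : 1 ≤ r ^ 2 * h)
    (hη₁ : η * (h + 66 * (r * h) + 2) ≤ r) (hη₂ : η * (h + 66 * (r * h) + 2) ^ 2 ≤ 1)
    (hk : (h - r * h) / 2 ≤ (k : ℝ) ∨ 1 ≤ p) (hC : 1137 ≤ C) :
    ∑' x : ℕ, P (eventB Z (x + 1) h p) ≤ ENNReal.ofReal ((C * r) ^ (p + 1) * h) := by
  have hh0 : (1 : ℝ) ≤ h := by exact_mod_cast H.one_le_h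
  have hD := H.one_le_D
  have hr0 : 0 < r := pos_of_mul_pos_left (by linarith) (by linarith : (0 : ℝ) ≤ h)
  have hη := H.η_nonneg
  refine (hZ.tsum_measure_eventB_le H.capBound_nonneg H.hitBound_supersolution
    H.capBound_supersolution p).trans (ENNReal.ofReal_le_ofReal ?_)
  match p with
  | 0 =>
    have hk' : (h - r * h) / 2 - 0 ≤ (k : ℝ) := by
      rw [sub_zero]
      exact hk.resolve_right (by norm_num)
    refine (H.hitBound_le_of_le le_rfl hk').trans ?_
    rw [zero_add, pow_one, mul_zero, add_zero, mul_assoc]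
    gcongr
    linarith
  | p + 1 =>
    refine (H.capBound_succ_le p k).trans ?_
    calc _ ≤ (1137 * (r ^ 2 * h)) * (17 * r) ^ p := by
          gcongr
          · linarith
          · linarith
      _ ≤ ((C ^ 2 * r ^ 2) * h) * (C * r) ^ p := by
          rw [← mul_assoc]
          gcongr
          · nlinarith
          · linarith
      _ = _ := by ring

/-- For every ε > 0 there exists a finite constant C such that for all integers
h ≥ 1, k ≥ 0 and p ≥ 0, if either k ∈ [(h − h^{1/2+ε})/2, (h + h^{1/2+ε})/2] or
p ≥ 1, and the chain Z starts at k, then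
Σ_{x=1}^∞ P(B_{x,h,p}) ≤ (C·h^{−1/2+ε})^{p+1}·h. -/
theorem stmt_4 :
    ∀ ε : ℝ, 0 < ε → ∃ C : ℝ,
      ∀ (h k p : ℕ), 1 ≤ h →
        ((((h : ℝ) - (h : ℝ) ^ ((1 : ℝ) / 2 + ε)) / 2 ≤ (k : ℝ) ∧
            (k : ℝ) ≤ ((h : ℝ) + (h : ℝ) ^ ((1 : ℝ) / 2 + ε)) / 2) ∨ 1 ≤ p) →
        ∀ (Ω : Type) (_ : MeasurableSpace Ω) (P : Measure Ω) (Z : ℕ → Ω → ℕ),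
          IsProbabilityMeasure P → IsMarkovChainFrom P Z rho k →
          ∑' x : ℕ, P (eventB Z (x + 1) h p) ≤
            ENNReal.ofReal ((C * (h : ℝ) ^ (-(1 : ℝ) / 2 + ε)) ^ (p + 1) * h) := by
  intro ε hε
  obtain ⟨h₀, hh₀⟩ := Filter.eventually_atTop.1 (eventually_rpow_mul_exp_le hε)
  refine ⟨max 1137 (2 ^ h₀ * h₀), ?_⟩
  intro h k p hh hk Ω _ P Z _ hZ
  have h1 : (1 : ℝ) ≤ h := by exact_mod_cast hh
  have h0 : (0 : ℝ) < h := by linarith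
  set r : ℝ := (h : ℝ) ^ (-(1 : ℝ) / 2 + ε) with hr
  have hr0 : 0 < r := Real.rpow_pos_of_pos h0 _
  have hrD : r * h = (h : ℝ) ^ ((1 : ℝ) / 2 + ε) := by
    rw [hr, ← Real.rpow_add_one h0.ne']
    congr 1
    ring
  have hrr : r ^ 2 * h = (h : ℝ) ^ (2 * ε) := by
    rw [hr, ← Real.rpow_natCast, ← Real.rpow_mul h0.le, ← Real.rpow_add_one h0.ne']
    congr 1
    push_cast
    ring
  have hD1 : 1 ≤ r * h := hrD ▸ Real.one_le_rpow h1 (by positivity)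
  have hr1 : 1 ≤ r ^ 2 * h := hrr ▸ Real.one_le_rpow h1 (by positivity)
  rcases Nat.lt_or_ge h h₀ with hlt | hge
  · refine (hZ.tsum_measure_eventB_le_two_pow h p).trans (ENNReal.ofReal_le_ofReal ?_)
    have hlt' : (h : ℝ) ≤ h₀ := by exact_mod_cast hlt.le
    have hC : (2 : ℝ) ^ h₀ ≤ max 1137 (2 ^ h₀ * (h₀ : ℝ)) * r := by
      calc (2 : ℝ) ^ h₀ ≤ 2 ^ h₀ * (r * h) := le_mul_of_one_le_right (by positivity) hD1
        _ ≤ 2 ^ h₀ * (r * h₀) := by gcongr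
        _ = 2 ^ h₀ * h₀ * r := by ring
        _ ≤ _ := by
          gcongr
          exact le_max_right _ _
    have hone : (1 : ℝ) ≤ 2 ^ h₀ := one_le_pow₀ (by norm_num)
    calc (2 : ℝ) ^ h ≤ 2 ^ h₀ := pow_le_pow_right₀ (by norm_num) hlt.le
      _ ≤ max 1137 (2 ^ h₀ * (h₀ : ℝ)) * r := hC
      _ ≤ (max 1137 (2 ^ h₀ * (h₀ : ℝ)) * r) ^ (p + 1) :=
        le_self_pow₀ (hone.trans hC) (Nat.succ_ne_zero p)
      _ ≤ _ := le_mul_of_one_le_right (by positivity) h1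
  · set η : ℝ := Real.exp (-((r * h) ^ 2 / (2 * h))) with hη
    have hη0 : 0 < η := Real.exp_pos _
    set y : ℝ := (h : ℝ) ^ (1 + ε) with hy
    have hhy : (h : ℝ) ≤ y := by
      conv_lhs => rw [← Real.rpow_one (h : ℝ)]
      exact Real.rpow_le_rpow_of_exponent_le h1 (by linarith)
    have hDy : r * h ≤ y := by
      rw [hrD]
      exact Real.rpow_le_rpow_of_exponent_le h1 (by linarith)
    have hy0 : 0 < y := by linarith
    have hysmall : 5000 * y ^ 3 * η ≤ 1 := by
      have := hh₀ h hge
      rw [← hrr, show r ^ 2 * h / 2 = (r * h) ^ 2 / (2 * h) by field_simp, ← hη] at this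
      rwa [hy, ← Real.rpow_natCast, ← Real.rpow_mul h0.le,
        show (1 + ε) * (3 : ℕ) = 3 + 3 * ε by push_cast; ring]
    have hy1 : 1 ≤ y := by linarith
    have hy23 : y ^ 2 * η ≤ y ^ 3 * η := by
      gcongr
      norm_num
    have hK : h + 66 * (r * h) + 2 ≤ 69 * y := by linarith
    have hsmall : h * η * (6 * h + 66 * (r * h) + 2) ≤ 1 :=
      calc h * η * (6 * h + 66 * (r * h) + 2) ≤ y * η * (74 * y) := by
            gcongr
            linarith
        _ = 74 * (y ^ 2 * η) := by ring
        _ ≤ 1 := by nlinarith [mul_pos (pow_pos hy0 3) hη0]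
    have hη₂ : η * (h + 66 * (r * h) + 2) ^ 2 ≤ 1 :=
      calc η * (h + 66 * (r * h) + 2) ^ 2 ≤ η * (69 * y) ^ 2 := by gcongr
        _ = 4761 * (y ^ 2 * η) := by ring
        _ ≤ 1 := by nlinarith [mul_pos (pow_pos hy0 3) hη0]
    have hη₁ : η * (h + 66 * (r * h) + 2) ≤ r := by
      have : η * (h + 66 * (r * h) + 2) * h ≤ r * h :=
        calc η * (h + 66 * (r * h) + 2) * h ≤ η * (69 * y) * y := by gcongr
          _ = 69 * (y ^ 2 * η) := by ring
          _ ≤ 1 := by nlinarith [mul_pos (pow_pos hy0 3) hη0]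
          _ ≤ r * h := hD1
      exact le_of_mul_le_mul_right this h0
    refine hZ.tsum_measure_eventB_le_of_small (LevelEstimates.of_small hh hD1 hr1 hη hsmall)
      hr1 hη₁ hη₂ ?_ (le_max_left _ _)
    rw [hrD]
    exact hk.imp_left And.left
end

section
/- For every ε > 0 there exists a finite constant C such that for every integer h ≥ 2 and every integer l with 1 ≤ l and (h − h^{1/2+ε})/2 ≤ l ≤ (h + h^{1/2+ε})/2: π(l, h−l) / Σ_{m ≥ h−l} π(l,m) < C·h^{−1/2+ε}. -/
open MeasureTheory ProbabilityTheory
open scoped ENNReal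

/-- π(0,j) := δ_{0,j} and, for i > 0, π(i,j) := 2^{−i−j}·(i+j−1)!/((i−1)!·j!). -/
noncomputable def piGW (i j : ℕ) : ℝ :=
  if i = 0 then (if j = 0 then 1 else 0)
  else (2 : ℝ) ^ (-(i : ℝ) - (j : ℝ)) * (Nat.factorial (i + j - 1)) /
    ((Nat.factorial (i - 1)) * (Nat.factorial j))


theorem piGW_pos {i : ℕ} (hi : 1 ≤ i) (j : ℕ) : 0 < piGW i j := by
  rw [piGW, if_neg (by omega)]
  positivity

theorem piGW_nonneg (i j : ℕ) : 0 ≤ piGW i j := by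
  rw [piGW]
  split_ifs <;> positivity

theorem piGW_succ {i : ℕ} (hi : 1 ≤ i) (j : ℕ) :
    piGW i (j + 1) * (2 * ((j : ℝ) + 1)) = piGW i j * ((i : ℝ) + j) := by
  obtain ⟨n, rfl⟩ : ∃ n, i = n + 1 := ⟨i - 1, by omega⟩
  have h2 : (2 : ℝ) ^ (-((n + 1 : ℕ) : ℝ) - (j : ℝ)) =
      2 * (2 : ℝ) ^ (-((n + 1 : ℕ) : ℝ) - ((j + 1 : ℕ) : ℝ)) := by
    rw [← Real.rpow_one_add' (by norm_num)]
    · congr 1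
      push_cast
      ring
    · have : (0 : ℝ) ≤ (n : ℝ) := n.cast_nonneg
      have : (0 : ℝ) ≤ (j : ℝ) := j.cast_nonneg
      push_cast
      linarith
  rw [piGW, piGW, if_neg (by omega), if_neg (by omega), h2,
    show n + 1 + (j + 1) - 1 = (n + j) + 1 by omega, show n + 1 + j - 1 = n + j by omega,
    Nat.factorial_succ, Nat.factorial_succ j]
  have := Nat.factorial_pos j
  have := Nat.factorial_pos (n + 1 - 1)
  push_cast
  field_simp
  ring

/-- As long as successive ratios are at least `1 / (1 + x)`, the values decay at most
geometrically. -/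
theorem le_mul_exp_of_le_mul_succ {a : ℕ → ℝ} (ha : ∀ k, 0 ≤ a k) {x : ℝ} {N : ℕ}
    (h : ∀ k < N, a k ≤ (1 + x) * a (k + 1)) :
    ∀ k ≤ N, a 0 ≤ Real.exp (x * k) * a k := by
  intro k
  induction k with
  | zero => simp
  | succ k ih =>
    intro hk
    calc a 0 ≤ Real.exp (x * k) * a k := ih (by omega)
      _ ≤ Real.exp (x * k) * (Real.exp x * a (k + 1)) := by
        gcongr
        refine (h k (by omega)).trans ?_
        gcongr
        · exact ha _
        · linarith [Real.add_one_le_exp x]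
      _ = Real.exp (x * (k + 1 : ℕ)) * a (k + 1) := by
        rw [← mul_assoc, ← Real.exp_add]
        push_cast
        ring_nf

theorem piGW_le_mul_succ {h l j k : ℕ} (hl : 1 ≤ l) (hlj : h ≤ l + j) {s x : ℝ}
    (hj : (j : ℝ) ≤ (h + s) / 2) (hx : 0 ≤ x) (hxs : x * h = 4 * s) (hk : (k : ℝ) ≤ s)
    (hs : 1 ≤ s) : piGW l (j + k) ≤ (1 + x) * piGW l (j + k + 1) := by
  have hrec := piGW_succ hl (j + k)
  have hp := piGW_pos hl (j + k + 1)
  have hlj' : (h : ℝ) ≤ l + j := by exact_mod_cast hlj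
  have hl' : (1 : ℝ) ≤ l := by exact_mod_cast hl
  push_cast at hrec
  have hpos : (0 : ℝ) < l + (j + k) := by positivity
  have hkx : 0 ≤ x * k := by positivity
  have hxlj : x * h ≤ x * (l + j) := by gcongr
  refine le_of_mul_le_mul_right ?_ hpos
  rw [← hrec, show (1 + x) * piGW l (j + k + 1) * ((l : ℝ) + (j + k)) =
    piGW l (j + k + 1) * ((1 + x) * (l + (j + k))) by ring]
  refine mul_le_mul_of_nonneg_left ?_ hp.le
  linarith

/-- For every ε > 0 there exists a finite constant C such that for every
integer h ≥ 2 and every integer l with 1 ≤ l and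
(h − h^{1/2+ε})/2 ≤ l ≤ (h + h^{1/2+ε})/2:
π(l, h−l) / Σ_{m ≥ h−l} π(l,m) < C·h^{−1/2+ε}. -/
theorem stmt_15 :
    ∀ ε : ℝ, 0 < ε → ∃ C : ℝ,
      ∀ (h l : ℕ), 2 ≤ h → 1 ≤ l →
        ((h : ℝ) - (h : ℝ) ^ ((1 : ℝ) / 2 + ε)) / 2 ≤ (l : ℝ) →
        (l : ℝ) ≤ ((h : ℝ) + (h : ℝ) ^ ((1 : ℝ) / 2 + ε)) / 2 →
        piGW l (h - l) / (∑' m : ℕ, if h - l ≤ m then piGW l m else 0) <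
          C * (h : ℝ) ^ (-(1 : ℝ) / 2 + ε) := by
  intro ε hε
  refine ⟨Real.exp 4 + 1, fun h l hh hl hlow _ => ?_⟩
  have hh1 : (1 : ℝ) ≤ h := by exact_mod_cast (by omega : 1 ≤ h)
  have hh0 : (0 : ℝ) < h := by linarith
  set s : ℝ := (h : ℝ) ^ ((1 : ℝ) / 2 + ε) with hs
  set t : ℝ := (h : ℝ) ^ (-(1 : ℝ) / 2 + ε) with ht
  have hs1 : 1 ≤ s := Real.one_le_rpow hh1 (by linarith)
  have ht0 : 0 < t := Real.rpow_pos_of_pos hh0 _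
  have hts : t * h = s := by
    rw [ht, hs, ← Real.rpow_add_one hh0.ne']
    ring_nf
  have htinv : t⁻¹ ≤ s := by
    rw [ht, hs, ← Real.rpow_neg hh0.le]
    exact Real.rpow_le_rpow_of_exponent_le hh1 (by linarith)
  set j := h - l with hj
  have hlj : h ≤ l + j := by omega
  have hj2 : (j : ℝ) ≤ (h + s) / 2 := by
    rcases le_total l h with hlh | hlh
    · rw [hj, Nat.cast_sub hlh]
      linarith
    · rw [hj, Nat.sub_eq_zero_of_le hlh]
      simp only [Nat.cast_zero]
      linarith
  have hp := piGW_pos hl j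
  have hC : 0 < (Real.exp 4 + 1) * t := by positivity
  set f : ℕ → ℝ := fun m => if j ≤ m then piGW l m else 0 with hf
  by_cases hsum : Summable f
  swap
  · rw [tsum_eq_zero_of_not_summable hsum, div_zero]
    exact hC
  have hf0 : ∀ m, 0 ≤ f m := fun m => by
    rw [hf]
    dsimp only
    split_ifs
    exacts [piGW_nonneg l m, le_rfl]
  set N := ⌈t⁻¹⌉₊ with hN
  have hterm : ∀ k < N, piGW l j ≤ Real.exp 4 * piGW l (j + k) := by
    intro k hk
    have hkt : (k : ℝ) < t⁻¹ := Nat.lt_ceil.mp hk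
    refine (le_mul_exp_of_le_mul_succ (a := fun k => piGW l (j + k)) (x := 4 * t) (N := k)
      (fun k => piGW_nonneg _ _) (fun i hi => ?_) k le_rfl).trans ?_
    · have hik : (i : ℝ) ≤ k := by exact_mod_cast hi.le
      exact piGW_le_mul_succ hl hlj hj2 (by positivity) (by rw [mul_assoc, hts])
        (by linarith) hs1
    · refine mul_le_mul_of_nonneg_right (Real.exp_le_exp.mpr ?_) (piGW_nonneg _ _)
      have : t * k ≤ t * t⁻¹ := by gcongr
      rw [mul_inv_cancel₀ ht0.ne'] at this
      linarith
  have hlower : t⁻¹ * piGW l j ≤ Real.exp 4 * ∑' m, f m := by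
    calc t⁻¹ * piGW l j ≤ N * piGW l j := by
          gcongr
          exact Nat.le_ceil _
      _ = ∑ _k ∈ Finset.range N, piGW l j := by simp
      _ ≤ ∑ k ∈ Finset.range N, Real.exp 4 * f (j + k) := by
          refine Finset.sum_le_sum fun k hk => ?_
          rw [hf]
          simpa using hterm k (Finset.mem_range.mp hk)
      _ = Real.exp 4 * ∑ m ∈ Finset.Ico j (j + N), f m := by
          rw [Finset.sum_Ico_eq_sum_range, Nat.add_sub_cancel_left, Finset.mul_sum]
      _ ≤ Real.exp 4 * ∑' m, f m := by
          gcongr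
          exact hsum.sum_le_tsum _ fun m _ => hf0 m
  have hT : 0 < ∑' m, f m := by
    have : 0 < Real.exp 4 * ∑' m, f m := lt_of_lt_of_le (by positivity) hlower
    exact pos_of_mul_pos_right this (Real.exp_pos 4).le
  rw [div_lt_iff₀ hT]
  calc piGW l j = t * (t⁻¹ * piGW l j) := by rw [mul_inv_cancel_left₀ ht0.ne']
    _ ≤ t * (Real.exp 4 * ∑' m, f m) := by gcongr
    _ < (Real.exp 4 + 1) * t * ∑' m, f m := by nlinarith [mul_pos ht0 hT]
end
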